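/- For L ≥ 2 copies of the ensemble E of the previous item, the factorized optimum is strictly smaller than the LOCC optimum of the sequence ensemble: Π_{l=1}^L p_L(E) = (2d^m/(d+3d^m))^L = η_{(1,…,1)} < p_L(⊗_{l=1}^L E); in particular optimal LOCC discrimination of this sequence ensemble is not factorizable. -/

import Mathlib

open Matrix BigOperators ComplexOrder

noncomputable section

/-- Tensor product of a family of local operators, one per party/step. -/
def tensorFam {m : ℕ} {ι : Fin m → Type*} [∀ k, Fintype (ι k)]
    (A : (k : Fin m) → Matrix (ι k) (ι k) ℂ) :
    Matrix ((k : Fin m) → ι k) ((k : Fin m) → ι k) ℂ :=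
  Matrix.of fun i j => ∏ k, A k (i k) (j k)

/-- Separable operator: a sum of tensor products of positive semidefinite local operators. -/
def IsSep {m : ℕ} {ι : Fin m → Type*} [∀ k, Fintype (ι k)]
    (E : Matrix ((k : Fin m) → ι k) ((k : Fin m) → ι k) ℂ) : Prop :=
  ∃ (S : Finset ℕ) (A : ℕ → (k : Fin m) → Matrix (ι k) (ι k) ℂ),
    (∀ s ∈ S, ∀ k, (A s k).PosSemidef) ∧ E = ∑ s ∈ S, tensorFam (A s)

/-- Separable state: separable with trace one. -/
def IsSepState {m : ℕ} {ι : Fin m → Type*} [∀ k, Fintype (ι k)]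
    (σ : Matrix ((k : Fin m) → ι k) ((k : Fin m) → ι k) ℂ) : Prop :=
  IsSep σ ∧ σ.trace = 1

/-- Block positive: nonnegative mean value on every separable state. -/
def IsBlockPos {m : ℕ} {ι : Fin m → Type*} [∀ k, Fintype (ι k)]
    (E : Matrix ((k : Fin m) → ι k) ((k : Fin m) → ι k) ℂ) : Prop :=
  ∀ σ, IsSepState σ → 0 ≤ ((E * σ).trace).re

def IsPOVM {α N : Type*} [Fintype α] [Fintype N] [DecidableEq N]
    (M : α → Matrix N N ℂ) : Prop :=
  (∀ i, (M i).PosSemidef) ∧ ∑ i, M i = 1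

/-- Average success probability of a guessing strategy. -/
def succProb {α N : Type*} [Fintype α] [Fintype N]
    (η : α → ℝ) (ρ M : α → Matrix N N ℂ) : ℝ :=
  ∑ i, η i * ((ρ i * M i).trace).re
/-- The m-qudit GHZ state Φ_d^m = (1/d) Σ_{a,b} |a⋯a⟩⟨b⋯b|. -/
def ghz (m d : ℕ) : Matrix ((_ : Fin m) → Fin d) ((_ : Fin m) → Fin d) ℂ :=
  Matrix.of fun i j =>
    if (∀ k k', i k = i k') ∧ (∀ k k', j k = j k') then (d : ℂ)⁻¹ else 0
/-- Tensor product over the sequence steps, with indices grouped by party: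
party k holds its parts of all L systems. -/
def stepTensor {L m : ℕ} {ι : Fin L → Fin m → Type*} [∀ l k, Fintype (ι l k)]
    (A : (l : Fin L) → Matrix ((k : Fin m) → ι l k) ((k : Fin m) → ι l k) ℂ) :
    Matrix ((k : Fin m) → (l : Fin L) → ι l k) ((k : Fin m) → (l : Fin L) → ι l k) ℂ :=
  Matrix.of fun i j => ∏ l, A l (fun k => i k l) (fun k => j k l)

/-- A sum restricted to the range of an injective map is a sum over its domain. -/
theorem sum_ite_mem_range {A B R : Type*} [Fintype A] [Fintype B] [AddCommMonoid R]
    {g : A → B} (hg : Function.Injective g) (p : B → Prop) [DecidablePred p]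
    (hp : ∀ b, p b ↔ ∃ a, g a = b) (f : B → R) :
    ∑ b, (if p b then f b else 0) = ∑ a, f (g a) := by
  classical
  symm
  refine Finset.sum_of_injOn g hg.injOn (by simp) ?_ ?_
  · intro b _ hb
    rw [if_neg]
    rw [hp]
    rintro ⟨a, rfl⟩
    exact hb ⟨a, by simp, rfl⟩
  · intro a _
    rw [if_pos ((hp _).2 ⟨a, rfl⟩)]

theorem sum_ite_const {m d : ℕ} (hm : 0 < m) {R : Type*} [AddCommMonoid R]
    (f : (Fin m → Fin d) → R) :
    ∑ i : Fin m → Fin d, (if ∀ k k', i k = i k' then f i else 0) = ∑ a, f (fun _ => a) :=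
  sum_ite_mem_range (fun _ _ h => congrFun h ⟨0, hm⟩) _
    (fun i => ⟨fun h => ⟨i ⟨0, hm⟩, funext fun _ => h _ _⟩, by rintro ⟨a, rfl⟩; simp⟩) f

theorem sum_ite_forall_const {m L d : ℕ} (hL : 0 < L) {R : Type*} [AddCommMonoid R]
    (f : (Fin m → Fin L → Fin d) → R) :
    ∑ i : Fin m → Fin L → Fin d, (if ∀ k, ∀ l l', i k l = i k l' then f i else 0) =
      ∑ a : Fin m → Fin d, f (fun k _ => a k) :=
  sum_ite_mem_range (g := fun (a : Fin m → Fin d) k (_ : Fin L) => a k)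
    (fun _ _ h => funext fun k => congrFun (congrFun h k) ⟨0, hL⟩) _
    (fun i => ⟨fun h => ⟨fun k => i k ⟨0, hL⟩, funext fun k => funext fun l => h k _ l⟩,
      by rintro ⟨a, rfl⟩; simp⟩) f

theorem posSemidef_ghz (m d : ℕ) : (ghz m d).PosSemidef := by
  let v : ((_ : Fin m) → Fin d) → ℂ := fun i => if ∀ k k', i k = i k' then 1 else 0
  have h : ghz m d = ((d : ℂ)⁻¹) • Matrix.vecMulVec v (star v) := by
    ext i j
    simp only [ghz, Matrix.of_apply, Matrix.smul_apply, Matrix.vecMulVec_apply, v, Pi.star_apply,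
      smul_eq_mul]
    rw [ite_and]
    split_ifs <;> simp
  rw [h]
  refine (Matrix.posSemidef_vecMulVec_self_star v).smul ?_
  rw [← Complex.ofReal_natCast, ← Complex.ofReal_inv]
  exact_mod_cast inv_nonneg.2 (Nat.cast_nonneg d)

theorem trace_mul_ghz {m d : ℕ} (hm : 0 < m)
    (A : Matrix ((_ : Fin m) → Fin d) ((_ : Fin m) → Fin d) ℂ) :
    (ghz m d * A).trace = (d : ℂ)⁻¹ * ∑ a, ∑ b, A (fun _ => b) (fun _ => a) := by
  simp only [Matrix.trace, Matrix.diag_apply, Matrix.mul_apply, ghz, Matrix.of_apply, ite_and,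
    ite_mul, zero_mul]
  have h : ∀ i : Fin m → Fin d,
      ∑ x : Fin m → Fin d, (if ∀ k k', i k = i k' then
        (if ∀ k k', x k = x k' then (d : ℂ)⁻¹ * A x i else 0) else 0) =
      if ∀ k k', i k = i k' then ∑ b, (d : ℂ)⁻¹ * A (fun _ => b) i else 0 := by
    intro i
    split_ifs with hi
    · exact sum_ite_const hm (fun x => (d : ℂ)⁻¹ * A x i)
    · simp
  simp_rw [h]
  rw [sum_ite_const hm (fun i => ∑ b, (d : ℂ)⁻¹ * A (fun _ => b) i)]
  simp [Finset.mul_sum]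

theorem trace_ghz {m d : ℕ} (hm : 0 < m) (hd : 0 < d) : (ghz m d).trace = 1 := by
  have hd' : (d : ℂ) ≠ 0 := by exact_mod_cast hd.ne'
  have h := trace_mul_ghz (d := d) hm 1
  rw [mul_one] at h
  rw [h]
  have : ∀ a b : Fin d, (1 : Matrix ((_ : Fin m) → Fin d) ((_ : Fin m) → Fin d) ℂ)
      (fun _ => b) (fun _ => a) = if a = b then 1 else 0 := by
    intro a b
    rw [Matrix.one_apply]
    congr 1
    exact propext ⟨fun h => (congrFun h ⟨0, hm⟩).symm, fun h => by rw [h]⟩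
  simp [this, hd']

theorem trace_tensorFam {m : ℕ} {ι : Fin m → Type*} [∀ k, Fintype (ι k)]
    (A : (k : Fin m) → Matrix (ι k) (ι k) ℂ) :
    (tensorFam A).trace = ∏ k, (A k).trace := by
  simp only [Matrix.trace, Matrix.diag_apply, tensorFam, Matrix.of_apply]
  exact (Fintype.prod_sum fun k i => A k i i).symm

theorem trace_stepTensor {L m : ℕ} {ι : Fin L → Fin m → Type*} [∀ l k, Fintype (ι l k)]
    (A : (l : Fin L) → Matrix ((k : Fin m) → ι l k) ((k : Fin m) → ι l k) ℂ) :
    (stepTensor A).trace = ∏ l, (A l).trace := by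
  simp only [Matrix.trace, Matrix.diag_apply, stepTensor, Matrix.of_apply]
  rw [Fintype.prod_sum fun l i => A l i i]
  exact (Equiv.piComm fun k l => ι l k).sum_comp fun i => ∏ l, A l (i l) (i l)

/-- The squared sum of products is at most the product of sums of squares. -/
theorem sq_sum_prod_le {m d : ℕ} (hm : 2 ≤ m) (x : Fin m → Fin d → ℝ) :
    (∑ a, ∏ k, x k a) ^ 2 ≤ ∏ k, ∑ a, x k a ^ 2 := by
  obtain ⟨n, rfl⟩ : ∃ n, m = n + 2 := ⟨m - 2, by omega⟩
  simp only [Fin.prod_univ_succ (n := n + 1)]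
  refine (Finset.sum_mul_sq_le_sq_mul_sq _ _ _).trans ?_
  gcongr
  simp only [← Finset.prod_pow]
  rw [Fintype.prod_sum fun (k : Fin (n + 1)) a => x k.succ a ^ 2,
    ← sum_ite_const n.succ_pos (fun i : Fin (n + 1) → Fin d => ∏ k, x k.succ (i k) ^ 2)]
  refine Finset.sum_le_sum fun i _ => ?_
  split_ifs
  · exact le_rfl
  · positivity

theorem norm_apply_le_of_posSemidef {n : Type*} [Fintype n] {A : Matrix n n ℂ}
    (hA : A.PosSemidef) (a b : n) : ‖A a b‖ ≤ √(A a a).re * √(A b b).re := by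
  have haa := Complex.nonneg_iff.1 (hA.diag_nonneg (i := a))
  have hbb := Complex.nonneg_iff.1 (hA.diag_nonneg (i := b))
  have hdet := (Complex.nonneg_iff.1 (hA.submatrix ![a, b]).det_nonneg).1
  have hba : A b a = star (A a b) := (hA.1.apply b a).symm
  rw [Matrix.det_fin_two] at hdet
  simp only [Matrix.submatrix_apply, Matrix.cons_val_zero, Matrix.cons_val_one, hba,
    Complex.star_def, Complex.mul_conj, Complex.sub_re, Complex.mul_re, Complex.ofReal_re,
    ← haa.2, zero_mul, sub_zero, Complex.normSq_eq_norm_sq] at hdet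
  rw [← Real.sqrt_mul haa.1]
  exact Real.le_sqrt_of_sq_le (by linarith)

/-- A product operator has overlap at most `1 / d` with the GHZ state. -/
theorem re_trace_ghz_mul_tensorFam_le {m d : ℕ} (hm : 2 ≤ m) (hd : 0 < d)
    (A : Fin m → Matrix (Fin d) (Fin d) ℂ) (hA : ∀ k, (A k).PosSemidef) :
    d * ((ghz m d * tensorFam A).trace).re ≤ ((tensorFam A).trace).re := by
  have hd' : (d : ℝ) ≠ 0 := by exact_mod_cast hd.ne'
  have hdiag : ∀ k a, A k a a = ((A k a a).re : ℂ) := fun k a =>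
    Complex.ext rfl (Complex.nonneg_iff.1 ((hA k).diag_nonneg (i := a))).2.symm
  have hpos : ∀ k a, 0 ≤ (A k a a).re := fun k a =>
    (Complex.nonneg_iff.1 ((hA k).diag_nonneg (i := a))).1
  have htr : ((tensorFam A).trace).re = ∏ k, ∑ a, √(A k a a).re ^ 2 := by
    rw [trace_tensorFam]
    have : ∀ k, (A k).trace = ((∑ a, √(A k a a).re ^ 2 : ℝ) : ℂ) := by
      intro k
      simp only [Matrix.trace, Matrix.diag_apply, Complex.ofReal_sum]
      refine Finset.sum_congr rfl fun a _ => ?_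
      rw [Real.sq_sqrt (hpos k a)]
      exact hdiag k a
    simp_rw [this, ← Complex.ofReal_prod, Complex.ofReal_re]
  rw [htr, trace_mul_ghz (by omega)]
  have : (d : ℝ) * ((d : ℂ)⁻¹ * ∑ a, ∑ b, tensorFam A (fun _ => b) (fun _ => a)).re =
      (∑ a, ∑ b, tensorFam A (fun _ => b) (fun _ => a)).re := by
    rw [← Complex.ofReal_natCast, ← Complex.ofReal_inv, Complex.re_ofReal_mul]
    field_simp
  rw [this]
  calc _ ≤ ‖∑ a, ∑ b, tensorFam A (fun _ => b) (fun _ => a)‖ := Complex.re_le_norm _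
    _ ≤ ∑ a, ∑ b, ∏ k, (√(A k b b).re * √(A k a a).re) := by
      refine (norm_sum_le _ _).trans (Finset.sum_le_sum fun a _ => ?_)
      refine (norm_sum_le _ _).trans (Finset.sum_le_sum fun b _ => ?_)
      simp only [tensorFam, Matrix.of_apply, norm_prod]
      gcongr with k
      exact norm_apply_le_of_posSemidef (hA k) b a
    _ = (∑ a, ∏ k, √(A k a a).re) ^ 2 := by
      simp only [Finset.prod_mul_distrib]
      rw [sq, Finset.sum_mul_sum, Finset.sum_comm]
    _ ≤ _ := sq_sum_prod_le hm _

theorem re_trace_ghz_mul_le_of_isSep {m d : ℕ} (hm : 2 ≤ m) (hd : 0 < d)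
    {E : Matrix ((_ : Fin m) → Fin d) ((_ : Fin m) → Fin d) ℂ}
    (hE : IsSep (ι := fun _ : Fin m => Fin d) E) :
    d * ((ghz m d * E).trace).re ≤ (E.trace).re := by
  obtain ⟨S, A, hA, rfl⟩ := hE
  rw [Matrix.mul_sum, Matrix.trace_sum, Matrix.trace_sum, Complex.re_sum, Complex.re_sum,
    Finset.mul_sum]
  exact Finset.sum_le_sum fun s hs => re_trace_ghz_mul_tensorFam_le hm hd (A s) (hA s hs)

theorem isSepState_tensorFam_ghz {m L d : ℕ} (hL : 0 < L) (hd : 0 < d) :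
    IsSepState (tensorFam fun _ : Fin m => ghz L d) := by
  refine ⟨⟨{0}, fun _ _ => ghz L d, fun _ _ _ => posSemidef_ghz L d, by simp⟩, ?_⟩
  rw [trace_tensorFam]
  simp [trace_ghz hL hd]

theorem trace_mul_tensorFam_ghz {m L d : ℕ} (hL : 0 < L)
    (X : Matrix ((_ : Fin m) → (_ : Fin L) → Fin d) ((_ : Fin m) → (_ : Fin L) → Fin d) ℂ) :
    (X * tensorFam fun _ : Fin m => ghz L d).trace =
      ((d : ℂ)⁻¹) ^ m * ∑ i : Fin m → Fin d, ∑ j : Fin m → Fin d, X (fun k _ => i k) (fun k _ => j k) := by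
  have hprod : ∀ J I : Fin m → Fin L → Fin d, ∏ k, ghz L d (J k) (I k) =
      if ∀ k, ∀ l l', I k l = I k l' then
        if ∀ k, ∀ l l', J k l = J k l' then ((d : ℂ)⁻¹) ^ m else 0 else 0 := by
    intro J I
    simp only [ghz, Matrix.of_apply]
    rw [← ite_and]
    simp [Fintype.prod_ite_zero, forall_and, and_comm]
  simp only [Matrix.trace, Matrix.diag_apply, Matrix.mul_apply, tensorFam, Matrix.of_apply, hprod,
    mul_ite, mul_zero]
  have h : ∀ I : Fin m → Fin L → Fin d,
      ∑ J : Fin m → Fin L → Fin d, (if ∀ k, ∀ l l', I k l = I k l' then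
        (if ∀ k, ∀ l l', J k l = J k l' then X I J * ((d : ℂ)⁻¹) ^ m else 0) else 0) =
      if ∀ k, ∀ l l', I k l = I k l' then
        ∑ j : Fin m → Fin d, X I (fun k _ => j k) * ((d : ℂ)⁻¹) ^ m else 0 := by
    intro I
    split_ifs with hI
    · exact sum_ite_forall_const hL (fun J => X I J * ((d : ℂ)⁻¹) ^ m)
    · simp
  simp_rw [h]
  rw [sum_ite_forall_const hL (fun I : Fin m → Fin L → Fin d =>
    ∑ j : Fin m → Fin d, X I (fun k _ => j k) * ((d : ℂ)⁻¹) ^ m)]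
  simp only [Finset.mul_sum, mul_comm]

/-- Mean value of the witness `(1 - dΦ) ⊗ (1 + d ^ m Φ) ⊗ ⋯` in the maximally entangled
product state, up to normalisation. -/
theorem sum_witness_neg {m d n : ℕ} (hm : 2 ≤ m) (hd : 2 ≤ d) (hn : 1 ≤ n) :
    ∑ i : Fin m → Fin d, ∑ j : Fin m → Fin d,
      ((if i = j then 1 else 0) -
        (if (∀ k k', i k = i k') ∧ (∀ k k', j k = j k') then (1 : ℝ) else 0)) *
      ((if i = j then 1 else 0) +
        (if (∀ k k', i k = i k') ∧ (∀ k k', j k = j k') then (d : ℝ) ^ (m - 1) else 0)) ^ n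
      < 0 := by
  set e : ℝ := (d : ℝ) ^ (m - 1) with he
  have hd2 : (2 : ℝ) ≤ d := by exact_mod_cast hd
  have he1 : 1 ≤ e := one_le_pow₀ (by linarith)
  have hen : e ≤ e ^ n := le_self_pow₀ he1 (by omega)
  have hde : (d : ℝ) ^ m = d * e := by
    rw [he, ← pow_succ']
    congr 1
    omega
  have hpt : ∀ i j : Fin m → Fin d,
      ((if i = j then 1 else 0) -
        (if (∀ k k', i k = i k') ∧ (∀ k k', j k = j k') then (1 : ℝ) else 0)) *
      ((if i = j then 1 else 0) +
        (if (∀ k k', i k = i k') ∧ (∀ k k', j k = j k') then e else 0)) ^ n =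
      (if i = j then 1 + (if ∀ k k', i k = i k' then e ^ n - 1 else 0) else 0) -
        (if ∀ k k', i k = i k' then if ∀ k k', j k = j k' then e ^ n else 0 else 0) := by
    intro i j
    have hn0 : n ≠ 0 := by omega
    rw [ite_and, ite_and]
    by_cases hij : i = j
    · subst hij
      split_ifs <;> simp
    · simp only [if_neg hij]
      split_ifs <;> simp [hn0]
  have hin : ∀ i : Fin m → Fin d,
      ∑ j : Fin m → Fin d,
        (if ∀ k k', i k = i k' then if ∀ k k', j k = j k' then e ^ n else 0 else 0) =
      if ∀ k k', i k = i k' then d * e ^ n else 0 := by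
    intro i
    split_ifs with hi
    · rw [sum_ite_const (by omega) (fun _ => e ^ n)]
      simp
    · simp
  simp_rw [hpt, Finset.sum_sub_distrib, hin]
  rw [sum_ite_const (by omega) (fun _ => d * e ^ n)]
  simp only [Finset.sum_ite_eq, Finset.mem_univ, if_true, Finset.sum_add_distrib]
  rw [sum_ite_const (by omega) (fun _ => e ^ n - 1)]
  simp only [Finset.sum_const, Finset.card_univ, Fintype.card_fun, Fintype.card_fin, nsmul_eq_mul,
    Nat.cast_pow, mul_one, hde]
  nlinarith [mul_nonneg (mul_nonneg (by linarith : (0 : ℝ) ≤ d) (by linarith : (0 : ℝ) ≤ d - 2))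
    (by linarith : 0 ≤ e ^ n), mul_nonneg (by linarith : (0 : ℝ) ≤ d) (by linarith : 0 ≤ e ^ n - e)]

/-- Replacing the guess `x` by the guess `c` on a state `σ` with `tr ρ_x = 1` changes the success
probability by the mean value of `η_c ρ_c - η_x ρ_x` in `σ`. -/
theorem succProb_two_outcome {α N : Type*} [Fintype α] [DecidableEq α] [Fintype N] [DecidableEq N]
    (η : α → ℝ) (ρ : α → Matrix N N ℂ) {x c : α} (hxc : x ≠ c) (hx : (ρ x).trace = 1)
    (σ : Matrix N N ℂ) :
    succProb η ρ (fun j => if j = c then σ else if j = x then 1 - σ else 0) =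
      η x + (η c * ((ρ c * σ).trace).re - η x * ((ρ x * σ).trace).re) := by
  rw [succProb, Fintype.sum_eq_add x c hxc]
  · simp only [if_neg hxc, if_true, mul_sub, mul_one, Matrix.trace_sub, hx, Complex.sub_re,
      Complex.one_re]
    ring
  · rintro j ⟨hjx, hjc⟩
    simp [hjx, hjc]

theorem trace_rho_zero {m d : ℕ} (hm : 0 < m) (hd : 0 < d) :
    ((2 * (d : ℂ) ^ m)⁻¹ • (1 + ((d : ℂ) ^ m) • ghz m d)).trace = 1 := by
  have hD : (d : ℂ) ^ m ≠ 0 := pow_ne_zero _ (by exact_mod_cast hd.ne')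
  simp only [Matrix.trace_smul, Matrix.trace_add, Matrix.trace_one, trace_ghz hm hd,
    Fintype.card_fun, Fintype.card_fin, smul_eq_mul, Nat.cast_pow]
  field_simp
  norm_num

/-- The mean value of `η_c ρ_c - η_1 ρ_1` in the maximally entangled product state is positive,
where `c` differs from the constant sequence in the first step only. -/
theorem sum_prod_entries_lt {m d n : ℕ} (hm : 2 ≤ m) (hd : 2 ≤ d) (hn : 1 ≤ n) {η₀ η₁ : ℝ}
    (hη0 : η₀ = 2 * (d : ℝ) ^ m / ((d : ℝ) + 3 * (d : ℝ) ^ m))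
    (hη1 : η₁ = ((d : ℝ) + (d : ℝ) ^ m) / ((d : ℝ) + 3 * (d : ℝ) ^ m)) :
    η₀ ^ (n + 1) * (∑ i : Fin m → Fin d, ∑ j : Fin m → Fin d,
      ((2 * (d : ℂ) ^ m)⁻¹ • (1 + ((d : ℂ) ^ m) • ghz m d)) i j ^ (n + 1)).re <
    η₁ * η₀ ^ n * (∑ i : Fin m → Fin d, ∑ j : Fin m → Fin d,
      ghz m d i j * ((2 * (d : ℂ) ^ m)⁻¹ • (1 + ((d : ℂ) ^ m) • ghz m d)) i j ^ n).re := by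
  have hd0 : (0 : ℝ) < d := by exact_mod_cast (by omega : 0 < d)
  have hD : (0 : ℝ) < (d : ℝ) ^ m := by positivity
  have hde : (d : ℝ) ^ m = d * (d : ℝ) ^ (m - 1) := by
    rw [← pow_succ']
    congr 1
    omega
  set r₁ : (Fin m → Fin d) → (Fin m → Fin d) → ℝ := fun i j =>
    if (∀ k k', i k = i k') ∧ (∀ k k', j k = j k') then (d : ℝ)⁻¹ else 0 with hr₁
  set r₀ : (Fin m → Fin d) → (Fin m → Fin d) → ℝ := fun i j =>
    (2 * (d : ℝ) ^ m)⁻¹ * ((if i = j then 1 else 0) + (d : ℝ) ^ m * r₁ i j) with hr₀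
  have h₁ : ∀ i j, ghz m d i j = (r₁ i j : ℂ) := by
    intro i j
    simp only [ghz, Matrix.of_apply, hr₁]
    split_ifs <;> simp
  have h₀ : ∀ i j, ((2 * (d : ℂ) ^ m)⁻¹ • (1 + ((d : ℂ) ^ m) • ghz m d)) i j = (r₀ i j : ℂ) := by
    intro i j
    simp only [Matrix.smul_apply, Matrix.add_apply, Matrix.one_apply, h₁, smul_eq_mul, hr₀]
    push_cast
    split_ifs <;> simp
  simp only [h₀, h₁, ← Complex.ofReal_pow, ← Complex.ofReal_mul, ← Complex.ofReal_sum,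
    Complex.ofReal_re, Finset.mul_sum]
  rw [← sub_neg]
  simp only [← Finset.sum_sub_distrib]
  have hw := mul_neg_of_pos_of_neg
    (by positivity : 0 < (((d : ℝ) + 3 * (d : ℝ) ^ m)⁻¹) ^ (n + 1)) (sum_witness_neg hm hd hn)
  refine lt_of_eq_of_lt ?_ hw
  simp only [Finset.mul_sum]
  refine Finset.sum_congr rfl fun i _ => Finset.sum_congr rfl fun j _ => ?_
  have e₀ : η₀ * r₀ i j = ((d : ℝ) + 3 * (d : ℝ) ^ m)⁻¹ * ((if i = j then 1 else 0) +
      (if (∀ k k', i k = i k') ∧ (∀ k k', j k = j k') then (d : ℝ) ^ (m - 1) else 0)) := by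
    have : (d : ℝ) ^ m * r₁ i j =
        if (∀ k k', i k = i k') ∧ (∀ k k', j k = j k') then (d : ℝ) ^ (m - 1) else 0 := by
      simp only [hr₁, hde]
      split_ifs
      · field_simp
      · simp
    simp only [hr₀, this, hη0]
    field_simp
  have e₁ : η₀ * r₀ i j - η₁ * r₁ i j = ((d : ℝ) + 3 * (d : ℝ) ^ m)⁻¹ *
      ((if i = j then 1 else 0) -
        (if (∀ k k', i k = i k') ∧ (∀ k k', j k = j k') then (1 : ℝ) else 0)) := by
    rw [e₀, hη1]
    simp only [hr₁]
    split_ifs <;> field_simp <;> rw [hde] <;> ring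
  calc _ = (η₀ * r₀ i j - η₁ * r₁ i j) * (η₀ * r₀ i j) ^ n := by ring_nf
    _ = _ := by
      rw [e₁, e₀, mul_pow]
      ring

/-- Guessing the first state without measuring is optimal among separable measurements. -/
theorem succProb_le_of_isSep {m d : ℕ} (hm : 2 ≤ m) (hd : 0 < d)
    {η : Fin 2 → ℝ} {ρ : Fin 2 → Matrix ((_ : Fin m) → Fin d) ((_ : Fin m) → Fin d) ℂ}
    (hη0 : η 0 = 2 * (d : ℝ) ^ m / ((d : ℝ) + 3 * (d : ℝ) ^ m))
    (hη1 : η 1 = ((d : ℝ) + (d : ℝ) ^ m) / ((d : ℝ) + 3 * (d : ℝ) ^ m))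
    (hρ0 : ρ 0 = (2 * (d : ℂ) ^ m)⁻¹ • (1 + ((d : ℂ) ^ m) • ghz m d))
    (hρ1 : ρ 1 = ghz m d)
    {M : Fin 2 → Matrix ((_ : Fin m) → Fin d) ((_ : Fin m) → Fin d) ℂ}
    (hM : IsPOVM M) (hsep : IsSep (ι := fun _ : Fin m => Fin d) (M 1)) :
    succProb η ρ M ≤ η 0 := by
  have hd0 : (0 : ℝ) < d := by exact_mod_cast hd
  have hD : (0 : ℝ) < (d : ℝ) ^ m := by positivity
  have hle := re_trace_ghz_mul_le_of_isSep hm hd hsep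
  have hM0 : M 0 = 1 - M 1 := by
    rw [← hM.2, Fin.sum_univ_two, add_sub_cancel_right]
  have htr : ((ρ 0 * M 0).trace).re =
      1 - (2 * (d : ℝ) ^ m)⁻¹ * ((M 1).trace.re + (d : ℝ) ^ m * ((ghz m d * M 1).trace).re) := by
    have h1 : (ρ 0).trace = 1 := by rw [hρ0, trace_rho_zero (by omega) hd]
    rw [hM0, mul_sub, mul_one, Matrix.trace_sub, h1, hρ0, Matrix.smul_mul, Matrix.add_mul,
      Matrix.one_mul, Matrix.smul_mul, Matrix.trace_smul, Matrix.trace_add, Matrix.trace_smul]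
    have hc : (2 * (d : ℂ) ^ m)⁻¹ = (((2 * (d : ℝ) ^ m)⁻¹ : ℝ) : ℂ) := by push_cast; rfl
    have hc' : (d : ℂ) ^ m = (((d : ℝ) ^ m : ℝ) : ℂ) := by push_cast; rfl
    rw [hc, hc', smul_eq_mul, smul_eq_mul, Complex.sub_re, Complex.one_re, Complex.re_ofReal_mul,
      Complex.add_re, Complex.re_ofReal_mul]
  rw [succProb, Fin.sum_univ_two, htr, hρ1, hη1, hη0]
  set t := (M 1).trace.re
  set g := ((ghz m d * M 1).trace).re
  have key : 2 * (d : ℝ) ^ m / ((d : ℝ) + 3 * (d : ℝ) ^ m) *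
        (1 - (2 * (d : ℝ) ^ m)⁻¹ * (t + (d : ℝ) ^ m * g)) +
        ((d : ℝ) + (d : ℝ) ^ m) / ((d : ℝ) + 3 * (d : ℝ) ^ m) * g =
      2 * (d : ℝ) ^ m / ((d : ℝ) + 3 * (d : ℝ) ^ m) -
        ((d : ℝ) + 3 * (d : ℝ) ^ m)⁻¹ * (t - d * g) := by
    field_simp
    ring
  rw [key]
  have := mul_nonneg (by positivity : 0 ≤ ((d : ℝ) + 3 * (d : ℝ) ^ m)⁻¹) (sub_nonneg.2 hle)
  linarith

/-- for L ≥ 2 copies of the ensemble of Example 1, the factorized optimum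
Π_l p_L(E) = (2d^m/(d+3d^m))^L = η_{(1,…,1)} is strictly smaller than the LOCC optimum
p_L(⊗_l E) of the sequence ensemble: optimal LOCC discrimination is not factorizable. -/
theorem example_not_factorizable (m d L : ℕ) (hm : 2 ≤ m) (hd : 2 ≤ d) (hL : 2 ≤ L)
    (η : Fin 2 → ℝ) (ρ : Fin 2 → Matrix ((_ : Fin m) → Fin d) ((_ : Fin m) → Fin d) ℂ)
    (hη0 : η 0 = 2 * (d : ℝ) ^ m / ((d : ℝ) + 3 * (d : ℝ) ^ m))
    (hη1 : η 1 = ((d : ℝ) + (d : ℝ) ^ m) / ((d : ℝ) + 3 * (d : ℝ) ^ m))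
    (hρ0 : ρ 0 = (2 * (d : ℂ) ^ m)⁻¹ • (1 + ((d : ℂ) ^ m) • ghz m d))
    (hρ1 : ρ 1 = ghz m d)
    -- a class of single-step LOCC measurements
    (C : Set (Fin 2 → Matrix ((_ : Fin m) → Fin d) ((_ : Fin m) → Fin d) ℂ))
    (hC : ∀ M ∈ C, IsPOVM M ∧ ∀ i, IsSep (M i))
    (htriv : ∀ x : Fin 2,
      (fun i => if i = x then (1 : Matrix ((_ : Fin m) → Fin d) ((_ : Fin m) → Fin d) ℂ) else 0) ∈ C)
    -- a class of LOCC measurements on the whole sequence space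
    (Cp : Set ((Fin L → Fin 2) →
      Matrix ((_ : Fin m) → (_ : Fin L) → Fin d) ((_ : Fin m) → (_ : Fin L) → Fin d) ℂ))
    (hCp : ∀ M ∈ Cp, IsPOVM M ∧
      ∀ c, IsSep (ι := fun _ : Fin m => (_ : Fin L) → Fin d) (M c))
    (htrivp : ∀ y : Fin L → Fin 2,
      (fun c => if c = y then
        (1 : Matrix ((_ : Fin m) → (_ : Fin L) → Fin d) ((_ : Fin m) → (_ : Fin L) → Fin d) ℂ)
        else 0) ∈ Cp)
    (htwop : ∀ x c : Fin L → Fin 2, x ≠ c →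
      ∀ σ : Matrix ((_ : Fin m) → (_ : Fin L) → Fin d) ((_ : Fin m) → (_ : Fin L) → Fin d) ℂ,
        IsSepState (ι := fun _ : Fin m => (_ : Fin L) → Fin d) σ →
        (fun j => if j = c then σ else if j = x then 1 - σ else 0) ∈ Cp)
    (hclosed : ∀ M : Fin L → Fin 2 → Matrix ((_ : Fin m) → Fin d) ((_ : Fin m) → Fin d) ℂ,
      (∀ l, M l ∈ C) → (fun c : Fin L → Fin 2 => stepTensor (fun l => M l (c l))) ∈ Cp)
    (pL : ℝ) (hpL : IsLUB ((fun M => succProb η ρ M) '' C) pL)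
    (pLtot : ℝ)
    (hpLtot : IsLUB ((fun M => succProb (fun c : Fin L → Fin 2 => ∏ l, η (c l))
      (fun c => stepTensor (fun l => ρ (c l))) M) '' Cp) pLtot) :
    pL = 2 * (d : ℝ) ^ m / ((d : ℝ) + 3 * (d : ℝ) ^ m) ∧
    pL ^ L = ∏ l : Fin L, η 0 ∧
    pL ^ L < pLtot := by
  have hd0 : 0 < d := by omega
  have htr : (ρ 0).trace = 1 := by rw [hρ0, trace_rho_zero (by omega) hd0]
  have hp : pL = η 0 := by
    refine hpL.unique (IsGreatest.isLUB ⟨⟨_, htriv 0, ?_⟩, ?_⟩)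
    · simp [succProb, htr]
    · rintro _ ⟨M, hM, rfl⟩
      exact succProb_le_of_isSep hm hd0 hη0 hη1 hρ0 hρ1 (hC M hM).1 ((hC M hM).2 1)
  refine ⟨hp.trans hη0, by simp [hp], ?_⟩
  obtain ⟨n, rfl⟩ : ∃ n, L = n + 1 := ⟨L - 1, by omega⟩
  let x : Fin (n + 1) → Fin 2 := fun _ => 0
  let c : Fin (n + 1) → Fin 2 := Fin.cons 1 fun _ => 0
  have hxc : x ≠ c := fun h => by simpa [x, c] using congrFun h 0
  have hle := hpLtot.1 ⟨_, htwop x c hxc _ (isSepState_tensorFam_ghz n.succ_pos hd0), rfl⟩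
  refine lt_of_lt_of_le ?_ hle
  beta_reduce
  rw [succProb_two_outcome _ _ hxc (by simp [trace_stepTensor, x, htr]),
    trace_mul_tensorFam_ghz n.succ_pos, trace_mul_tensorFam_ghz n.succ_pos, hp]
  have hlt := sum_prod_entries_lt hm hd (by omega : 1 ≤ n) hη0 hη1
  rw [← hρ0, ← hρ1] at hlt
  have hcast : ((d : ℂ)⁻¹) ^ m = ((((d : ℝ)⁻¹) ^ m : ℝ) : ℂ) := by push_cast; rfl
  have hpos : 0 < ((d : ℝ)⁻¹) ^ m := by positivity
  simp only [stepTensor, Matrix.of_apply, hcast, Complex.re_ofReal_mul, Fin.prod_univ_succ, x, c,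
    Fin.cons_zero, Fin.cons_succ, Finset.prod_const, Finset.card_univ, Fintype.card_fin,
    ← pow_succ']
  have := mul_lt_mul_of_pos_left hlt hpos
  linarith
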